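/- Equip K = H* with the product m_K(φ ⊗ ψ)(x) = Σ_{i,j} φ(a_j·x'·a_i)·ψ(S(b_i)·b_j·x'') (the coend product on the coend of mod_l(H), with unit ε). Then the right integral μ^r is a two-sided cointegral for this product: m_K(μ^r ⊗ φ) = m_K(φ ⊗ μ^r) = φ(1)·μ^r for every φ ∈ H*. -/

import Mathlib

/- STATEMENT 8: for the coend product `m_K` on `K = H*`, the right integral `μʳ` is a
two-sided cointegral: `m_K(μʳ ⊗ φ) = m_K(φ ⊗ μʳ) = φ(1)·μʳ`. -/

noncomputable section

open scoped TensorProduct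
open TensorProduct

/-- Symmetric linear forms on `H`. -/
def IsSLF {H : Type} [Ring H] [Algebra ℂ H] (φ : Module.Dual ℂ H) : Prop :=
  ∀ x y : H, φ (x * y) = φ (y * x)

/-- The convolution product on the dual of a Hopf algebra: `(φψ)(x) = φ(x')ψ(x'')`. -/
def conv {H : Type} [Ring H] [HopfAlgebra ℂ H] (φ ψ : Module.Dual ℂ H) :
    Module.Dual ℂ H :=
  LinearMap.mul' ℂ ℂ ∘ₗ TensorProduct.map φ ψ ∘ₗ (Coalgebra.comul (R := ℂ) (A := H))

/-- The coend product on `K = H*`: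
`m_K(φ ⊗ ψ)(x) = Σ_{i,j} φ(aⱼ x' aᵢ) ψ(S(bᵢ) bⱼ x'')`. -/
def mK {H ι : Type} [Ring H] [HopfAlgebra ℂ H] [Fintype ι]
    (aR bR : ι → H) (φ ψ : Module.Dual ℂ H) : Module.Dual ℂ H :=
  ∑ i, ∑ j, conv
    (φ ∘ₗ LinearMap.mulLeft ℂ (aR j) ∘ₗ LinearMap.mulRight ℂ (aR i))
    (ψ ∘ₗ LinearMap.mulLeft ℂ (HopfAlgebra.antipode (R := ℂ) (bR i) * bR j))

section Convolution

open Coalgebra HopfAlgebra LinearMap WithConv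

variable {K H A : Type*} [Field K] [Ring H] [HopfAlgebra K H] [Ring A] [Algebra K A]

/-- The embedding `x ↦ x ⊗ 1`. -/
abbrev inclL (K H : Type*) [Field K] [Ring H] [HopfAlgebra K H] : H →ₐ[K] H ⊗[K] H :=
  Algebra.TensorProduct.includeLeft

/-- The embedding `x ↦ 1 ⊗ x`. -/
abbrev inclR (K H : Type*) [Field K] [Ring H] [HopfAlgebra K H] : H →ₐ[K] H ⊗[K] H :=
  Algebra.TensorProduct.includeRight

theorem algHom_antipode_conv_self (F : H →ₐ[K] A) :
    toConv (F.toLinearMap ∘ₗ antipode K) * toConv F.toLinearMap = 1 := by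
  have h := algHom_comp_convMul_distrib F (toConv (antipode K (A := H))) (toConv LinearMap.id)
  rw [antipode_mul_id] at h
  apply WithConv.ext
  refine h.symm.trans ?_
  ext x
  simp

theorem algHom_conv_antipode (F : H →ₐ[K] A) :
    toConv F.toLinearMap * toConv (F.toLinearMap ∘ₗ antipode K) = 1 := by
  have h := algHom_comp_convMul_distrib F (toConv LinearMap.id) (toConv (antipode K (A := H)))
  rw [id_mul_antipode] at h
  apply WithConv.ext
  refine h.symm.trans ?_
  ext x
  simp

theorem inclL_conv_inclR :
    toConv (inclL K H).toLinearMap * toConv (inclR K H).toLinearMap = toConv (comul (R := K)) := by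
  ext x
  rw [(ℛ K x).convMul_apply]
  simp [(ℛ K x).eq]

theorem comul_conv_inclR_antipode :
    toConv (comul (R := K)) * toConv ((inclR K H).toLinearMap ∘ₗ antipode K)
      = toConv (inclL K H).toLinearMap := by
  rw [← inclL_conv_inclR, mul_assoc, algHom_conv_antipode, mul_one]

theorem inclL_antipode_conv_comul :
    toConv ((inclL K H).toLinearMap ∘ₗ antipode K) * toConv (comul (R := K))
      = toConv (inclR K H).toLinearMap := by
  rw [← inclL_conv_inclR, ← mul_assoc, algHom_antipode_conv_self, one_mul]

theorem comul_comp_antipode :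
    toConv (comul (R := K) ∘ₗ antipode K (A := H))
      = toConv ((inclR K H).toLinearMap ∘ₗ antipode K)
        * toConv ((inclL K H).toLinearMap ∘ₗ antipode K) := by
  refine (left_inv_eq_right_inv (a := toConv (comul (R := K) (A := H))) ?_
    comul_right_inv).symm
  rw [← inclL_conv_inclR, mul_assoc, ← mul_assoc _ (toConv (inclL K H).toLinearMap),
    algHom_antipode_conv_self, one_mul, algHom_antipode_conv_self]

end Convolution

section Slice

variable {K H : Type*} [Field K] [Ring H] [HopfAlgebra K H]

/-- The left slice map `x ⊗ y ↦ β(x) y`. -/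
def slice (β : Module.Dual K H) : H ⊗[K] H →ₗ[K] H :=
  (TensorProduct.lid K H).toLinearMap ∘ₗ LinearMap.rTensor H β

@[simp]
theorem slice_tmul (β : Module.Dual K H) (x y : H) : slice β (x ⊗ₜ y) = β x • y := by
  simp [slice]

theorem slice_mul_inclR (β : Module.Dual K H) (t : H ⊗[K] H) (y : H) :
    slice β (t * inclR K H y) = slice β t * y := by
  induction t with
  | zero => simp
  | tmul a b => simp
  | add s t hs ht => simp only [add_mul, map_add, hs, ht]

theorem slice_inclR_mul (β : Module.Dual K H) (t : H ⊗[K] H) (y : H) :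
    slice β (inclR K H y * t) = y * slice β t := by
  induction t with
  | zero => simp
  | tmul a b => simp
  | add s t hs ht => simp only [mul_add, map_add, hs, ht]

theorem slice_inclL_mul (β : Module.Dual K H) (t : H ⊗[K] H) (y : H) :
    slice β (inclL K H y * t) = slice (β ∘ₗ LinearMap.mulLeft K y) t := by
  induction t with
  | zero => simp
  | tmul a b => simp
  | add s t hs ht => simp only [mul_add, map_add, hs, ht]

theorem slice_mul_inclL (β : Module.Dual K H) (t : H ⊗[K] H) (y : H) :
    slice β (t * inclL K H y) = slice (β ∘ₗ LinearMap.mulRight K y) t := by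
  induction t with
  | zero => simp
  | tmul a b => simp
  | add s t hs ht => simp only [add_mul, map_add, hs, ht]

end Slice

section Integral

open Coalgebra HopfAlgebra LinearMap WithConv

variable {K H : Type*} [Field K] [Ring H] [HopfAlgebra K H]

/-- `(lam ⊗ id)(Δ(x)) = lam(x) 1` for all `x`. -/
def IsRightIntegral (lam : Module.Dual K H) : Prop :=
  ∀ x : H, slice lam (comul (R := K) x) = lam x • (1 : H)

theorem isRightIntegral_comp_antipode_inv {Sinv : H →ₗ[K] H}
    (hS : ∀ x, Sinv (antipode K x) = x) (hS' : ∀ x, antipode K (Sinv x) = x)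
    {mu : Module.Dual K H}
    (hmu : ∀ x, TensorProduct.rid K H (LinearMap.lTensor H mu (comul (R := K) x)) = mu x • (1 : H)) :
    IsRightIntegral (mu ∘ₗ Sinv) := by
  intro x
  obtain ⟨y, rfl⟩ : ∃ y, antipode K y = x := ⟨_, hS' x⟩
  have h := congr($(comul_comp_antipode (K := K) (H := H)) y)
  rw [(ℛ K y).convMul_apply] at h
  have h2 := congrArg (antipode K) (hmu y)
  rw [← (ℛ K y).eq] at h2
  simp only [map_sum, LinearMap.lTensor_tmul, TensorProduct.rid_tmul, map_smul, antipode_one] at h2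
  simp only [LinearMap.comp_apply] at h ⊢
  rw [h, hS, ← h2]
  simp [hS]

theorem slice_comul_mul_inclL {lam : Module.Dual K H} (hlam : IsRightIntegral lam) (x y : H) :
    slice lam (comul (R := K) x * inclL K H y)
      = antipode K (slice (lam ∘ₗ LinearMap.mulLeft K x) (comul (R := K) y)) := by
  have h := congr($(comul_conv_inclR_antipode (K := K) (H := H)) y)
  rw [(ℛ K y).convMul_apply] at h
  simp only [AlgHom.toLinearMap_apply, LinearMap.comp_apply] at h
  rw [← h, Finset.mul_sum, map_sum]
  conv_rhs => rw [← (ℛ K y).eq]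
  simp only [map_sum, ← mul_assoc, slice_mul_inclR, ← Bialgebra.comul_mul, hlam _]
  simp

theorem sum_antipode_inv_mul {Sinv : H →ₗ[K] H}
    (hS : ∀ x, Sinv (antipode K x) = x) (hS' : ∀ x, antipode K (Sinv x) = x) (y : H) :
    LinearMap.mul' K H (TensorProduct.map Sinv LinearMap.id
      (TensorProduct.comm K H H (comul (R := K) y))) = algebraMap K H (counit y) := by
  have hinj : Function.Injective (antipode K (A := H)) := Function.LeftInverse.injective hS
  apply hinj
  rw [← (ℛ K y).eq]
  simp [antipode_mul_antidistrib, hS', sum_antipode_mul_eq_smul, Algebra.algebraMap_eq_smul_one]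

theorem inclR_mul_comul_cointegral {Λ : H} (hΛ : ∀ x : H, x * Λ = counit (R := K) x • Λ) (x : H) :
    inclR K H x * comul (R := K) Λ = inclL K H (antipode K x) * comul (R := K) Λ := by
  have h := congr($(inclL_antipode_conv_comul (K := K) (H := H)) x)
  rw [(ℛ K x).convMul_apply] at h
  simp only [AlgHom.toLinearMap_apply, LinearMap.comp_apply] at h
  rw [← h, Finset.sum_mul]
  simp only [mul_assoc, ← Bialgebra.comul_mul, hΛ]
  have h2 := congr($(mul_one (toConv (LinearMap.id : H →ₗ[K] H))) x)
  rw [(ℛ K x).convMul_apply] at h2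
  conv_rhs => rw [← LinearMap.id_apply (R := K) x, ← h2]
  simp [Finset.sum_mul, Algebra.algebraMap_eq_smul_one]

theorem comul_cointegral_mul_inclL {Λ : H} {α : H →ₐ[K] K} (hΛ : ∀ x : H, Λ * x = α x • Λ) :
    toConv (LinearMap.mulLeft K (comul (R := K) Λ) ∘ₗ (inclL K H).toLinearMap)
      = toConv ((Algebra.ofId K (H ⊗[K] H)).comp α).toLinearMap
        * toConv (LinearMap.mulLeft K (comul (R := K) Λ) ∘ₗ (inclR K H).toLinearMap
          ∘ₗ antipode K) := by
  ext x
  have h := congr($(comul_conv_inclR_antipode (K := K) (H := H)) x)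
  rw [(ℛ K x).convMul_apply] at h ⊢
  simp only [AlgHom.toLinearMap_apply, LinearMap.comp_apply, LinearMap.mulLeft_apply] at h ⊢
  rw [← h, Finset.mul_sum]
  simp only [← mul_assoc, ← Bialgebra.comul_mul, hΛ]
  simp [Algebra.ofId_apply, Algebra.algebraMap_eq_smul_one]

theorem comul_cointegral_mul_inclR_antipode {Λ : H} {α : H →ₐ[K] K}
    (hΛ : ∀ x : H, Λ * x = α x • Λ) :
    toConv (LinearMap.mulLeft K (comul (R := K) Λ) ∘ₗ (inclR K H).toLinearMap ∘ₗ antipode K)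
      = toConv (((Algebra.ofId K (H ⊗[K] H)).comp α).toLinearMap ∘ₗ antipode K)
        * toConv (LinearMap.mulLeft K (comul (R := K) Λ) ∘ₗ (inclL K H).toLinearMap) := by
  rw [comul_cointegral_mul_inclL hΛ, ← mul_assoc, algHom_antipode_conv_self, one_mul]

variable [FiniteDimensional K H]

theorem eq_sum_slice_tmul (t : H ⊗[K] H) :
    t = ∑ k, TensorProduct.rid K H
      (LinearMap.lTensor H ((Module.finBasis K H).coord k) t) ⊗ₜ[K] Module.finBasis K H k := by
  induction t with
  | zero => simp
  | tmul a b =>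
    conv_lhs => rw [← (Module.finBasis K H).sum_repr b, TensorProduct.tmul_sum]
    simp [TensorProduct.smul_tmul]
  | add s t hs ht =>
    conv_lhs => rw [hs, ht]
    simp [TensorProduct.add_tmul, Finset.sum_add_distrib]

theorem IsRightIntegral.eq_zero_of_forall_mul {Sinv : H →ₗ[K] H}
    (hS : ∀ x, Sinv (antipode K x) = x) (hS' : ∀ x, antipode K (Sinv x) = x)
    {lam : Module.Dual K H} (hlam : IsRightIntegral lam) (h0 : lam ≠ 0) {y : H}
    (hy : ∀ x, lam (x * y) = 0) : y = 0 := by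
  have hinj : Function.Injective (antipode K (A := H)) := Function.LeftInverse.injective hS
  have hslice : ∀ z : H, (∀ x, lam (x * z) = 0) → ∀ (f : Module.Dual K H) (x : H),
      lam (x * TensorProduct.rid K H (LinearMap.lTensor H f (comul (R := K) z))) = 0 := by
    intro z hz f x
    have h := slice_comul_mul_inclL hlam x z
    have hz : lam ∘ₗ LinearMap.mulRight K z = 0 := by
      ext w
      simp [hz]
    rw [slice_mul_inclL, hz] at h
    have h2 : slice (lam ∘ₗ LinearMap.mulLeft K x) (comul (R := K) z) = 0 := by
      apply hinj
      rw [← h]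
      simp [slice]
    have h3 := congrArg f h2
    rw [← (ℛ K z).eq] at h3 ⊢
    simpa [Finset.mul_sum, mul_comm] using h3
  have counit_zero : ∀ z : H, (∀ x, lam (x * z) = 0) → counit (R := K) z = 0 := by
    intro z hz
    by_contra hne
    apply h0
    ext x
    have h := congrArg (LinearMap.mulLeft K x) (sum_antipode_inv_mul hS hS' z)
    rw [eq_sum_slice_tmul (comul (R := K) z)] at h
    replace h := congrArg lam h
    simp only [map_sum, TensorProduct.comm_tmul, TensorProduct.map_tmul, LinearMap.mul'_apply,
      LinearMap.id_apply, LinearMap.mulLeft_apply, ← mul_assoc, hslice z hz,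
      Finset.sum_const_zero] at h
    rw [Algebra.algebraMap_eq_smul_one, mul_smul_comm, mul_one, map_smul, smul_eq_mul] at h
    simpa [hne] using h.symm
  rw [← Module.forall_dual_apply_eq_zero_iff K]
  intro f
  have h := counit_zero _ (hslice y hy f)
  have h2 := congrArg f (sum_counit_smul (ℛ K y))
  rw [← h2]
  rw [← (ℛ K y).eq] at h
  simpa [mul_comm] using h

/-- The Radford–Larson–Sweedler data: a left cointegral normalized by `lam`. -/
theorem IsRightIntegral.exists_left_cointegral {Sinv : H →ₗ[K] H}
    (hS : ∀ x, Sinv (antipode K x) = x) (hS' : ∀ x, antipode K (Sinv x) = x)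
    {lam : Module.Dual K H} (hlam : IsRightIntegral lam) (h0 : lam ≠ 0) :
    ∃ Λ : H, lam Λ = 1 ∧ (∀ x : H, x * Λ = counit (R := K) x • Λ) ∧
      ∃ α : H →ₐ[K] K, ∀ x, Λ * x = α x • Λ := by
  have nondeg : ∀ y z : H, (∀ x, lam (x * y) = lam (x * z)) → y = z := by
    intro y z h
    rw [← sub_eq_zero]
    refine hlam.eq_zero_of_forall_mul hS hS' h0 fun x ↦ ?_
    rw [mul_sub, map_sub, h, sub_self]
  have hinj : Function.Injective ((LinearMap.mul K H).flip.compr₂ lam) := by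
    intro y z h
    exact nondeg y z fun x ↦ by simpa using congr($h x)
  have hsurj := (LinearMap.injective_iff_surjective_of_finrank_eq_finrank
    (Subspace.dual_finrank_eq (K := K) (V := H)).symm).mp hinj
  obtain ⟨Λ, hΛ⟩ := hsurj (counit (R := K) (A := H))
  have hΛ (x : H) : lam (x * Λ) = counit (R := K) x := by simpa using congr($hΛ x)
  have h1 : lam Λ = 1 := by simpa using hΛ 1
  have hleft (x : H) : x * Λ = counit (R := K) x • Λ := by
    refine nondeg _ _ fun z ↦ ?_
    rw [← mul_assoc, hΛ, Bialgebra.counit_mul, mul_smul_comm, map_smul, hΛ, smul_eq_mul, mul_comm]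
  have hright (x : H) : Λ * x = lam (Λ * x) • Λ := by
    refine nondeg _ _ fun z ↦ ?_
    rw [← mul_assoc, hleft, smul_mul_assoc, map_smul, mul_smul_comm, map_smul, hΛ, smul_eq_mul,
      smul_eq_mul, mul_comm]
  refine ⟨Λ, h1, hleft, AlgHom.ofLinearMap (lam ∘ₗ LinearMap.mulLeft K Λ) (by simpa) ?_, ?_⟩
  · intro x y
    simp only [LinearMap.comp_apply, LinearMap.mulLeft_apply]
    rw [← mul_assoc, hright x, smul_mul_assoc, map_smul, map_smul, h1, smul_eq_mul, smul_eq_mul,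
      mul_one]
  · intro x
    simpa using hright x

theorem slice_comul_cointegral_injective {lam : Module.Dual K H} (hlam : IsRightIntegral lam)
    {Λ : H} (h1 : lam Λ = 1) (hΛ : ∀ x : H, x * Λ = counit (R := K) x • Λ) {β γ : Module.Dual K H}
    (h : slice β (comul (R := K) Λ) = slice γ (comul (R := K) Λ)) : β = γ := by
  let F : Module.Dual K H →ₗ[K] H :=
    (TensorProduct.lid K H).toLinearMap ∘ₗ LinearMap.applyₗ (comul (R := K) Λ)
      ∘ₗ LinearMap.rTensorHom H
  have hsurj : Function.Surjective F := by
    intro y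
    refine ⟨lam ∘ₗ LinearMap.mulLeft K (antipode K y), ?_⟩
    change slice _ _ = _
    rw [← slice_inclL_mul, ← inclR_mul_comul_cointegral hΛ, slice_inclR_mul, hlam, h1, one_smul,
      mul_one]
  exact (LinearMap.injective_iff_surjective_of_finrank_eq_finrank
    (Subspace.dual_finrank_eq (K := K) (V := H))).mpr hsurj h

/-- In the unimodular case the Nakayama automorphism of a right integral is `S²`. -/
theorem IsRightIntegral.map_mul_comm {lam : Module.Dual K H} (hlam : IsRightIntegral lam)
    {Λ : H} (h1 : lam Λ = 1) (hΛ : ∀ x : H, x * Λ = counit (R := K) x • Λ)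
    (hΛ' : ∀ x : H, Λ * x = counit (R := K) x • Λ) (x y : H) :
    lam (x * y) = lam (antipode K (antipode K y) * x) := by
  have key : lam ∘ₗ LinearMap.mulRight K y
      = lam ∘ₗ LinearMap.mulLeft K (antipode K (antipode K y)) := by
    refine slice_comul_cointegral_injective hlam h1 hΛ ?_
    rw [← slice_inclL_mul, ← inclR_mul_comul_cointegral hΛ, slice_inclR_mul, hlam, h1, one_smul,
      mul_one, ← slice_mul_inclL, slice_comul_mul_inclL hlam]
    congr 1
    have h2 : lam ∘ₗ LinearMap.mulLeft K Λ = counit (R := K) := by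
      ext z
      simp [hΛ', h1]
    rw [h2]
    simp [slice]
  exact congr($key x)

end Integral

section RMatrix

open Coalgebra HopfAlgebra LinearMap WithConv

variable {K H A ι : Type*} [Field K] [Ring H] [HopfAlgebra K H] [Ring A] [Algebra K A] [Fintype ι]

/-- `∑ i, a i ⊗ b i` is a universal R-matrix of `H`. -/
structure IsUniversalRMatrix (K : Type*) {H ι : Type*} [Field K] [Ring H] [HopfAlgebra K H]
    [Fintype ι] (a b : ι → H) : Prop where
  isUnit : IsUnit (∑ i, a i ⊗ₜ[K] b i : H ⊗[K] H)
  mul_comul (x : H) : (∑ i, a i ⊗ₜ[K] b i) * comul (R := K) x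
    = TensorProduct.comm K H H (comul (R := K) x) * ∑ i, a i ⊗ₜ[K] b i
  comul_left : (∑ i, comul (R := K) (a i) ⊗ₜ[K] b i)
    = ∑ i, ∑ j, (a i ⊗ₜ[K] a j) ⊗ₜ[K] (b i * b j)
  comul_right : (∑ i, a i ⊗ₜ[K] comul (R := K) (b i))
    = ∑ i, ∑ j, (a i * a j) ⊗ₜ[K] (b j ⊗ₜ[K] b i)

namespace IsUniversalRMatrix

variable {a b : ι → H}

theorem sum_conv_left_mul (hR : IsUniversalRMatrix K a b) (f g : WithConv (H →ₗ[K] A))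
    (c : H →ₗ[K] A) :
    ∑ i, (f * g) (a i) * c (b i) = ∑ i, ∑ j, f (a i) * g (a j) * c (b i * b j) := by
  have h := congrArg (LinearMap.mul' K A ∘ₗ TensorProduct.map
    (LinearMap.mul' K A ∘ₗ TensorProduct.map f.ofConv g.ofConv) c) hR.comul_left
  simpa using h

theorem sum_conv_right_mul (hR : IsUniversalRMatrix K a b) (f g : WithConv (H →ₗ[K] A))
    (c : H →ₗ[K] A) :
    ∑ i, (f * g) (b i) * c (a i) = ∑ i, ∑ j, f (b j) * g (b i) * c (a i * a j) := by
  have h := congrArg (LinearMap.mul' K A ∘ₗ TensorProduct.map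
    (LinearMap.mul' K A ∘ₗ TensorProduct.map f.ofConv g.ofConv) c
    ∘ₗ (TensorProduct.comm K H (H ⊗[K] H)).toLinearMap) hR.comul_right
  simpa using h

theorem sum_counit_left (hR : IsUniversalRMatrix K a b) :
    ∑ i, counit (R := K) (a i) • b i = 1 := by
  have h := hR.sum_conv_left_mul 1 (toConv (inclL K H).toLinearMap) (inclR K H).toLinearMap
  have h2 : inclR K H (∑ i, counit (R := K) (a i) • b i) * ∑ i, a i ⊗ₜ[K] b i
      = 1 * ∑ i, a i ⊗ₜ[K] b i := by
    rw [one_mul, map_sum, Finset.sum_mul_sum]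
    simpa [Algebra.algebraMap_eq_smul_one] using h.symm
  have h3 := congrArg (slice (counit (R := K))) (hR.isUnit.mul_right_cancel h2)
  simpa [Algebra.TensorProduct.one_def] using h3

theorem sum_counit_right (hR : IsUniversalRMatrix K a b) :
    ∑ i, counit (R := K) (b i) • a i = 1 := by
  have h := hR.sum_conv_right_mul 1 (toConv (inclR K H).toLinearMap) (inclL K H).toLinearMap
  have h2 : (∑ i, a i ⊗ₜ[K] b i) * inclL K H (∑ i, counit (R := K) (b i) • a i)
      = (∑ i, a i ⊗ₜ[K] b i) * 1 := by
    rw [mul_one, map_sum, Finset.sum_mul_sum]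
    simpa [Algebra.algebraMap_eq_smul_one] using h.symm
  have h3 := congrArg (fun t ↦ slice (counit (R := K)) (TensorProduct.comm K H H t))
    (hR.isUnit.mul_left_cancel h2)
  simpa [Algebra.TensorProduct.one_def] using h3

theorem sum_mul_of_conv_left (hR : IsUniversalRMatrix K a b) {f g : WithConv (H →ₗ[K] A)}
    (hfg : f * g = 1) (c : H →ₗ[K] A) :
    ∑ i, ∑ j, f (a i) * g (a j) * c (b i * b j) = c 1 := by
  rw [← hR.sum_conv_left_mul, hfg, ← hR.sum_counit_left]
  simp [Algebra.algebraMap_eq_smul_one]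

theorem sum_mul_of_conv_right (hR : IsUniversalRMatrix K a b) {f g : WithConv (H →ₗ[K] A)}
    (hfg : f * g = 1) (c : H →ₗ[K] A) :
    ∑ i, ∑ j, f (b j) * g (b i) * c (a i * a j) = c 1 := by
  rw [← hR.sum_conv_right_mul, hfg, ← hR.sum_counit_right]
  simp [Algebra.algebraMap_eq_smul_one]

/-- `(S ⊗ S)(R) = R`. -/
theorem antipode_tmul_antipode (hR : IsUniversalRMatrix K a b) :
    ∑ i, antipode K (a i) ⊗ₜ[K] antipode K (b i) = ∑ i, a i ⊗ₜ[K] b i := by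
  have h1 : (∑ i, antipode K (a i) ⊗ₜ[K] b i) * (∑ i, a i ⊗ₜ[K] b i) = 1 := by
    have h := hR.sum_mul_of_conv_left (algHom_antipode_conv_self (inclL K H))
      (inclR K H).toLinearMap
    simpa [Finset.sum_mul_sum, Algebra.TensorProduct.one_def] using h
  have h2 : (∑ i, antipode K (a i) ⊗ₜ[K] antipode K (b i))
      * (∑ i, antipode K (a i) ⊗ₜ[K] b i) = 1 := by
    have h := hR.sum_mul_of_conv_right (algHom_antipode_conv_self (inclR K H))
      ((inclL K H).toLinearMap ∘ₗ antipode K)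
    rw [Finset.sum_comm] at h
    simpa [Finset.sum_mul_sum, antipode_mul_antidistrib, Algebra.TensorProduct.one_def] using h
  exact left_inv_eq_right_inv h2 h1

theorem sum_antipode_antipode (hR : IsUniversalRMatrix K a b) (f c : H →ₗ[K] A) :
    ∑ i, f (antipode K (a i)) * c (antipode K (b i)) = ∑ i, f (a i) * c (b i) := by
  simpa using congrArg (LinearMap.mul' K A ∘ₗ TensorProduct.map f c) hR.antipode_tmul_antipode

theorem sum_antipode_sq_mul (hR : IsUniversalRMatrix K a b) :
    ∑ i, ∑ j, (antipode K (antipode K (a i)) * a j) ⊗ₜ[K] (antipode K (b i) * b j)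
      = (1 : H ⊗[K] H) := by
  have h := hR.sum_mul_of_conv_left (algHom_conv_antipode (inclL K H)) (inclR K H).toLinearMap
  have h2 := congrArg (TensorProduct.map (antipode K) (antipode K)) h
  have h3 : (∑ i, antipode K (antipode K (a i)) ⊗ₜ[K] antipode K (b i))
      * ∑ i, a i ⊗ₜ[K] b i = 1 := by
    rw [← hR.antipode_tmul_antipode, Finset.sum_mul_sum, Finset.sum_comm]
    simpa [antipode_mul_antidistrib, Algebra.TensorProduct.one_def] using h2
  simpa [Finset.sum_mul_sum] using h3

theorem sum_mul_antipode_sq (hR : IsUniversalRMatrix K a b) :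
    ∑ i, ∑ j, (a j * a i) ⊗ₜ[K] (antipode K (antipode K (b j)) * antipode K (b i))
      = (1 : H ⊗[K] H) := by
  have h := hR.sum_mul_of_conv_right (algHom_conv_antipode (inclR K H)) (inclL K H).toLinearMap
  have h2 := congrArg (TensorProduct.map LinearMap.id (antipode K)) h
  rw [Finset.sum_comm]
  simpa [antipode_mul_antidistrib, Algebra.TensorProduct.one_def] using h2

/-- The antipode squared fixes `(α ⊗ id)(R)`. -/
theorem antipode_sq_leg (hR : IsUniversalRMatrix K a b) (α : H →ₐ[K] K) :
    antipode K (antipode K (∑ i, α (a i) • b i)) = ∑ i, α (a i) • b i := by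
  set h := ∑ i, α (a i) • b i with hdef
  have h1 := hR.sum_mul_of_conv_right (algHom_antipode_conv_self (AlgHom.id K H))
    ((Algebra.ofId K H).comp α).toLinearMap
  have h2 := hR.sum_mul_of_conv_right (algHom_conv_antipode (AlgHom.id K H))
    ((Algebra.ofId K H).comp α).toLinearMap
  replace h1 : antipode K h * h = 1 := by
    rw [Finset.sum_comm] at h1
    rw [← map_one ((Algebra.ofId K H).comp α)]
    refine Eq.trans ?_ h1
    simp [hdef, Finset.sum_mul_sum, Algebra.ofId_apply, Algebra.algebraMap_eq_smul_one, smul_smul,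
      mul_comm]
  replace h2 : h * antipode K h = 1 := by
    rw [Finset.sum_comm] at h2
    rw [← map_one ((Algebra.ofId K H).comp α)]
    refine Eq.trans ?_ h2
    simp [hdef, Finset.sum_mul_sum, Algebra.ofId_apply, Algebra.algebraMap_eq_smul_one, smul_smul,
      mul_comm]
  refine left_inv_eq_right_inv (a := antipode K h) ?_ h1
  rw [← antipode_mul_antidistrib, h2, antipode_one]

theorem comul_cointegral_mul_flip (hR : IsUniversalRMatrix K a b) {Λ : H} {α : H →ₐ[K] K}
    (hΛ : ∀ x : H, Λ * x = α x • Λ) :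
    comul (R := K) Λ * ∑ i, b i ⊗ₜ[K] a i
      = comul (R := K) Λ * inclR K H ((∑ i, antipode K (b i) * a i) * ∑ i, α (b i) • a i) := by
  have h := hR.sum_conv_right_mul (toConv ((Algebra.ofId K (H ⊗[K] H)).comp α).toLinearMap)
    (toConv (LinearMap.mulLeft K (comul (R := K) Λ) ∘ₗ (inclR K H).toLinearMap ∘ₗ antipode K))
    (inclR K H).toLinearMap
  rw [← comul_cointegral_mul_inclL hΛ] at h
  rw [Finset.sum_mul_sum, map_sum, Finset.mul_sum, Finset.mul_sum]
  simp only [map_sum, Finset.mul_sum]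
  simpa [mul_assoc, Algebra.ofId_apply, Algebra.algebraMap_eq_smul_one] using h

theorem comul_cointegral_mul_flip' (hR : IsUniversalRMatrix K a b) {Λ : H} {α : H →ₐ[K] K}
    (hΛ : ∀ x : H, Λ * x = α x • Λ) :
    comul (R := K) Λ * ∑ i, b i ⊗ₜ[K] a i
      = comul (R := K) Λ * inclL K H ((∑ i, a i * antipode K (b i)) * ∑ i, α (a i) • b i) := by
  have h := hR.sum_conv_left_mul
    (toConv (((Algebra.ofId K (H ⊗[K] H)).comp α).toLinearMap ∘ₗ antipode K))
    (toConv (LinearMap.mulLeft K (comul (R := K) Λ) ∘ₗ (inclL K H).toLinearMap))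
    ((inclL K H).toLinearMap ∘ₗ antipode K)
  rw [← comul_cointegral_mul_inclR_antipode hΛ] at h
  have h2 : ∑ i, α (antipode K (a i)) • antipode K (b i) = ∑ i, α (a i) • b i := by
    simpa [Algebra.ofId_apply, Algebra.algebraMap_eq_smul_one] using
      hR.sum_antipode_antipode ((Algebra.ofId K H).comp α).toLinearMap LinearMap.id
  have h3 : ∑ i, b i ⊗ₜ[K] a i = ∑ i, antipode K (b i) ⊗ₜ[K] antipode K (a i) := by
    simpa using congrArg (TensorProduct.comm K H H) hR.antipode_tmul_antipode.symm
  rw [h3, ← h2, Finset.sum_mul_sum, Finset.sum_comm, map_sum, Finset.mul_sum, Finset.mul_sum]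
  simp only [map_sum, Finset.mul_sum]
  simpa [mul_assoc, Algebra.ofId_apply, Algebra.algebraMap_eq_smul_one,
    antipode_mul_antidistrib] using h

/-- A left cointegral relates `u S(u)` to the legs of `R` contracted with the modular function. -/
theorem drinfeld_mul_antipode_drinfeld [FiniteDimensional K H] (hR : IsUniversalRMatrix K a b)
    {lam : Module.Dual K H} (hlam : IsRightIntegral lam) {Λ : H} {α : H →ₐ[K] K}
    (h1 : lam Λ = 1) (hΛ : ∀ x : H, x * Λ = counit (R := K) x • Λ)
    (hΛ' : ∀ x : H, Λ * x = α x • Λ) {u : H} (hu : u = ∑ i, antipode K (b i) * a i) :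
    u * antipode K u
      = antipode K u * (∑ i, α (a i) • b i) * (u * ∑ i, α (b i) • a i) := by
  set P := comul (R := K) Λ with hP
  set R := ∑ i, a i ⊗ₜ[K] b i with hRdef
  let τ := Algebra.TensorProduct.comm K H H
  have hSu : antipode K u = ∑ i, a i * antipode K (b i) := by
    rw [hu, map_sum]
    simpa [antipode_mul_antidistrib] using
      hR.sum_antipode_antipode LinearMap.id (antipode K (A := H))
  have hRP₁ : R * P = inclL K H (antipode K u) * P := by
    rw [hSu, map_sum, hRdef, Finset.sum_mul, Finset.sum_mul]
    refine Finset.sum_congr rfl fun i _ ↦ ?_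
    rw [map_mul, mul_assoc, ← inclR_mul_comul_cointegral hΛ, ← mul_assoc]
    simp [hP]
  have hRP₂ : R * P = inclR K H u * P := by
    rw [hu, map_sum, hRdef, ← hR.antipode_tmul_antipode, Finset.sum_mul, Finset.sum_mul]
    refine Finset.sum_congr rfl fun i _ ↦ ?_
    rw [map_mul, mul_assoc, inclR_mul_comul_cointegral hΛ, ← mul_assoc]
    simp [hP]
  have hτR' : τ R = ∑ i, b i ⊗ₜ[K] a i := by simp [hRdef, τ]
  have hPR₁ : P * τ R = P * inclR K H (u * ∑ i, α (b i) • a i) := by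
    rw [hτR', hu]
    exact hR.comul_cointegral_mul_flip hΛ'
  have hPR₂ : P * τ R = P * inclL K H (antipode K u * ∑ i, α (a i) • b i) := by
    rw [hτR', hSu]
    exact hR.comul_cointegral_mul_flip' hΛ'
  have hτ : τ (R * P) = P * τ R := by
    rw [hRdef, hP, hR.mul_comul, map_mul]
    congr 1
    exact (TensorProduct.comm K H H).symm_apply_apply _
  have hτL (x : H) : τ (inclL K H x) = inclR K H x := by simp [τ]
  have hτR (x : H) : τ (inclR K H x) = inclL K H x := by simp [τ]
  have hE₁ : inclL K H (antipode K u) * P = τ P * inclL K H (u * ∑ i, α (b i) • a i) := by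
    apply τ.injective
    have hττ : τ (τ P) = P := (TensorProduct.comm K H H).symm_apply_apply _
    rw [← hRP₁, hτ, hPR₁, map_mul τ, hττ, hτL]
  have hE₂ : inclL K H u * τ P = P * inclL K H (antipode K u * ∑ i, α (a i) • b i) := by
    rw [← hPR₂, ← hτ, hRP₂, map_mul, hτR]
  have hE : inclL K H (u * antipode K u) * P
      = P * inclL K H (antipode K u * (∑ i, α (a i) • b i) * (u * ∑ i, α (b i) • a i)) := by
    rw [map_mul, mul_assoc, hE₁, ← mul_assoc, hE₂, mul_assoc, ← map_mul]
  rw [← sub_eq_zero, ← Module.forall_dual_apply_eq_zero_iff K]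
  intro β
  have h := congrArg (slice β) hE
  rw [slice_inclL_mul, slice_mul_inclL] at h
  simpa [sub_eq_zero, mul_assoc] using congr($(slice_comul_cointegral_injective hlam h1 hΛ h) 1)

/-- The modular function of a left cointegral is killed by the monodromy of a ribbon Hopf algebra. -/
theorem leg_mul_leg_eq_one [FiniteDimensional K H] (hR : IsUniversalRMatrix K a b)
    {lam : Module.Dual K H} (hlam : IsRightIntegral lam) {Λ : H} {α : H →ₐ[K] K}
    (h1 : lam Λ = 1) (hΛ : ∀ x : H, x * Λ = counit (R := K) x • Λ)
    (hΛ' : ∀ x : H, Λ * x = α x • Λ) {v vinv g gi : H} (hv₁ : v * vinv = 1) (hv₂ : vinv * v = 1)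
    (hvcentral : ∀ x : H, v * x = x * v) (hSv : antipode K v = v)
    (hg : g = (∑ i, antipode K (b i) * a i) * vinv) (hgi₁ : g * gi = 1) (hgi₂ : gi * g = 1)
    (hgg : comul (R := K) g = g ⊗ₜ[K] g)
    (hgS : ∀ x : H, antipode K (antipode K x) * g = g * x) :
    (∑ i, α (a i) • b i) * ∑ i, α (b i) • a i = 1 := by
  have hu : g * v = ∑ i, antipode K (b i) * a i := by rw [hg, mul_assoc, hv₂, mul_one]
  have hεg : algebraMap K H (counit (R := K) g) = 1 := by
    have h := congrArg (TensorProduct.lid K H) (Coalgebra.rTensor_counit_comul (R := K) g)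
    rw [hgg] at h
    simpa [hgi₁, Algebra.algebraMap_eq_smul_one] using congrArg (· * gi) h
  have hSg : antipode K g = gi := by
    have h := mul_antipode_rTensor_comul_apply (R := K) g
    rw [hgg, hεg] at h
    exact left_inv_eq_right_inv (by simpa using h) hgi₁
  have hSu : antipode K (g * v) = v * gi := by rw [antipode_mul_antidistrib, hSv, hSg]
  have h := hR.drinfeld_mul_antipode_drinfeld hlam h1 hΛ hΛ' hu
  have hcomm := hgS (∑ i, α (a i) • b i)
  rw [hR.antipode_sq_leg] at hcomm
  rw [hSu] at h
  generalize (∑ i, α (a i) • b i) = x at *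
  generalize (∑ i, α (b i) • a i) = y at *
  have h2 : v * v * 1 = v * v * (x * y) := by
    calc v * v * 1 = v * v * (g * gi) := by rw [hgi₁]
      _ = v * (g * v) * gi := by rw [← hvcentral g]; simp only [mul_assoc]
      _ = g * v * (v * gi) := by rw [hvcentral (g * v)]; simp only [mul_assoc]
      _ = v * gi * x * (g * v * y) := h
      _ = v * (gi * (x * g) * v) * y := by simp only [mul_assoc]
      _ = v * (x * v) * y := by rw [hcomm, ← mul_assoc gi, hgi₂, one_mul]
      _ = v * v * (x * y) := by rw [← hvcentral x]; simp only [mul_assoc]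
  have hvu : IsUnit v := ⟨⟨v, vinv, hv₁, hv₂⟩, rfl⟩
  exact ((hvu.mul hvu).mul_left_cancel h2).symm

theorem modular_eq_counit (hR : IsUniversalRMatrix K a b)
    (hfact : Function.Injective fun β : Module.Dual K H ↦
      ∑ i, ∑ j, β (a i * b j) • (b i * a j)) {α : H →ₐ[K] K}
    (hα : (∑ i, α (a i) • b i) * ∑ i, α (b i) • a i = 1) (x : H) :
    α x = counit (R := K) x := by
  refine congr($(hfact (a₁ := α.toLinearMap) (a₂ := counit (R := K)) ?_) x)
  have h : (∑ i, counit (R := K) (a i) • b i) * ∑ i, counit (R := K) (b i) • a i = 1 := by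
    rw [hR.sum_counit_left, hR.sum_counit_right, one_mul]
  rw [← h, Finset.sum_mul_sum, Finset.sum_mul_sum] at hα
  simpa [smul_smul, mul_comm] using hα

end IsUniversalRMatrix

end RMatrix

section CoendProduct

variable {H ι : Type} [Ring H] [HopfAlgebra ℂ H] [Fintype ι] {aR bR : ι → H}
  {lam : Module.Dual ℂ H}

theorem mK_rightIntegral_left (hR : IsUniversalRMatrix ℂ aR bR) (hlam : IsRightIntegral lam)
    (hcyc : ∀ x y : H, lam (x * y)
      = lam (HopfAlgebra.antipode ℂ (HopfAlgebra.antipode ℂ y) * x)) (φ : Module.Dual ℂ H) :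
    mK aR bR lam φ = φ 1 • lam := by
  ext x
  have hx (l r : H) : ∑ i, ∑ j, lam (aR j * (l * aR i))
      * φ (HopfAlgebra.antipode ℂ (bR i) * bR j * r) = lam l * φ r := by
    have h := congrArg (LinearMap.mul' ℂ ℂ ∘ₗ TensorProduct.map
      (lam ∘ₗ LinearMap.mulRight ℂ l) (φ ∘ₗ LinearMap.mulRight ℂ r)) hR.sum_antipode_sq_mul
    simp only [← mul_assoc (aR _) l, hcyc _ (aR _)]
    simpa [Algebra.TensorProduct.one_def, mul_assoc] using h
  have h := congrArg φ (hlam x)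
  rw [← (Coalgebra.Repr.arbitrary ℂ x).eq] at h
  simp only [mK, conv, LinearMap.sum_apply, LinearMap.comp_apply]
  rw [← (Coalgebra.Repr.arbitrary ℂ x).eq]
  simp only [map_sum, TensorProduct.map_tmul, LinearMap.mul'_apply, LinearMap.comp_apply,
    LinearMap.mulLeft_apply, LinearMap.mulRight_apply]
  simp only [Finset.sum_comm (s := Finset.univ) (t := (Coalgebra.Repr.arbitrary ℂ x).index), hx]
  simpa [mul_comm] using h

theorem mK_rightIntegral_right (hR : IsUniversalRMatrix ℂ aR bR) (hlam : IsRightIntegral lam)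
    (hcyc : ∀ x y : H, lam (x * y)
      = lam (HopfAlgebra.antipode ℂ (HopfAlgebra.antipode ℂ y) * x)) (φ : Module.Dual ℂ H) :
    mK aR bR φ lam = φ 1 • lam := by
  ext x
  have hx (l r : H) : ∑ i, ∑ j, φ (r * aR j * aR i)
      * lam (HopfAlgebra.antipode ℂ (bR i) * (l * bR j)) = lam l * φ r := by
    have h := congrArg (LinearMap.mul' ℂ ℂ ∘ₗ TensorProduct.map
      (φ ∘ₗ LinearMap.mulLeft ℂ r) (lam ∘ₗ LinearMap.mulRight ℂ l)) hR.sum_mul_antipode_sq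
    simp only [← mul_assoc _ l, hcyc _ (bR _)]
    simpa [Algebra.TensorProduct.one_def, mul_assoc, mul_comm] using h
  have hΔ (i : ι) := congrArg (LinearMap.mul' ℂ ℂ ∘ₗ TensorProduct.map
    (φ ∘ₗ LinearMap.mulRight ℂ (aR i))
    (lam ∘ₗ LinearMap.mulLeft ℂ (HopfAlgebra.antipode ℂ (bR i)))) (hR.mul_comul x)
  have h := congrArg φ (hlam x)
  rw [← (Coalgebra.Repr.arbitrary ℂ x).eq] at h hΔ
  simp only [mK, conv, LinearMap.sum_apply, LinearMap.comp_apply]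
  rw [← (Coalgebra.Repr.arbitrary ℂ x).eq]
  simp only [map_sum, Finset.mul_sum, Finset.sum_mul, Algebra.TensorProduct.tmul_mul_tmul,
    TensorProduct.comm_tmul, TensorProduct.map_tmul, LinearMap.mul'_apply, LinearMap.comp_apply,
    LinearMap.mulLeft_apply, LinearMap.mulRight_apply] at hΔ ⊢
  have hstep (i : ι) := (Finset.sum_comm.trans (hΔ i)).trans Finset.sum_comm
  simp only [mul_assoc] at hstep hx ⊢
  simp only [hstep, Finset.sum_comm (s := Finset.univ)
    (t := (Coalgebra.Repr.arbitrary ℂ x).index), hx]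
  simpa [mul_comm] using h

end CoendProduct

theorem right_integral_is_two_sided_cointegral
    {H : Type} [Ring H] [HopfAlgebra ℂ H] [FiniteDimensional ℂ H]
    -- the antipode is invertible
    (Sinv : H →ₗ[ℂ] H)
    (hSinv₁ : ∀ x : H, Sinv (HopfAlgebra.antipode (R := ℂ) x) = x)
    (hSinv₂ : ∀ x : H, HopfAlgebra.antipode (R := ℂ) (Sinv x) = x)
    -- an invertible R-matrix `R = Σᵢ aᵢ ⊗ bᵢ`
    {ι : Type} [Fintype ι] (aR bR : ι → H)
    (hRinv : IsUnit (∑ i, aR i ⊗ₜ[ℂ] bR i : H ⊗[ℂ] H))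
    -- `R Δ(x) = Δᵒᵖ(x) R`
    (hRΔ : ∀ x : H,
      (∑ i, aR i ⊗ₜ[ℂ] bR i) * Coalgebra.comul (R := ℂ) x
        = (TensorProduct.comm ℂ H H) (Coalgebra.comul (R := ℂ) x)
            * ∑ i, aR i ⊗ₜ[ℂ] bR i)
    -- `(Δ ⊗ id)(R) = R₁₃ R₂₃`
    (hR₁ : (∑ i, (Coalgebra.comul (R := ℂ) (aR i)) ⊗ₜ[ℂ] bR i)
        = ∑ i, ∑ j, (aR i ⊗ₜ[ℂ] aR j) ⊗ₜ[ℂ] (bR i * bR j))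
    -- `(id ⊗ Δ)(R) = R₁₃ R₁₂`
    (hR₂ : (∑ i, aR i ⊗ₜ[ℂ] (Coalgebra.comul (R := ℂ) (bR i)))
        = ∑ i, ∑ j, (aR i * aR j) ⊗ₜ[ℂ] (bR j ⊗ₜ[ℂ] bR i))
    -- a ribbon element `v`
    (v vinv : H) (hv₁ : v * vinv = 1) (hv₂ : vinv * v = 1)
    (hvcentral : ∀ x : H, v * x = x * v)
    (hSv : HopfAlgebra.antipode (R := ℂ) v = v)
    (hεv : Coalgebra.counit (R := ℂ) v = 1)
    -- `Δ(v) = (R'R)⁻¹ (v ⊗ v)`, i.e. `R' R Δ(v) = v ⊗ v`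
    (hΔv : (∑ i, bR i ⊗ₜ[ℂ] aR i) * ((∑ i, aR i ⊗ₜ[ℂ] bR i)
            * Coalgebra.comul (R := ℂ) v) = v ⊗ₜ[ℂ] v)
    -- factorizability: `β ↦ (β ⊗ id)(RR')` is bijective
    (hfact : Function.Bijective fun β : Module.Dual ℂ H =>
        ∑ i, ∑ j, β (aR i * bR j) • (bR i * aR j))
    -- the pivotal element `g = u v⁻¹`, where `u = Σᵢ S(bᵢ) aᵢ` is the Drinfeld element;
    -- `g` is invertible, grouplike and implements `S²`
    (g gi : H)
    (hg : g = (∑ i, HopfAlgebra.antipode (R := ℂ) (bR i) * aR i) * vinv)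
    (hgi₁ : g * gi = 1) (hgi₂ : gi * g = 1)
    (hggrouplike : Coalgebra.comul (R := ℂ) g = g ⊗ₜ[ℂ] g)
    (hgS₂ : ∀ x : H,
      HopfAlgebra.antipode (R := ℂ) (HopfAlgebra.antipode (R := ℂ) x) * g = g * x)
    -- a left integral `μˡ` and the right integral `μʳ = μˡ ∘ S⁻¹`
    (μl μr : Module.Dual ℂ H) (hμl0 : μl ≠ 0)
    (hμl : ∀ x : H, (TensorProduct.rid ℂ H)
        ((LinearMap.lTensor H μl) (Coalgebra.comul (R := ℂ) x)) = μl x • (1 : H))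
    (hμr : μr = μl ∘ₗ Sinv) :
    ∀ φ : Module.Dual ℂ H,
      mK aR bR μr φ = φ 1 • μr ∧ mK aR bR φ μr = φ 1 • μr := by
  subst hμr
  have hlam := isRightIntegral_comp_antipode_inv hSinv₁ hSinv₂ hμl
  have hR : IsUniversalRMatrix ℂ aR bR := ⟨hRinv, hRΔ, hR₁, hR₂⟩
  have h0 : μl ∘ₗ Sinv ≠ 0 := by
    intro h
    apply hμl0
    ext x
    simpa [hSinv₁] using congr($h (HopfAlgebra.antipode ℂ x))
  generalize μl ∘ₗ Sinv = μr at *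
  obtain ⟨Λ, h1, hΛ, α, hα⟩ := hlam.exists_left_cointegral hSinv₁ hSinv₂ h0
  have hαε := hR.modular_eq_counit hfact.injective (hR.leg_mul_leg_eq_one hlam h1 hΛ hα hv₁ hv₂
    hvcentral hSv hg hgi₁ hgi₂ hggrouplike hgS₂)
  have hcyc := hlam.map_mul_comm h1 hΛ fun x ↦ by rw [hα, hαε]
  intro φ
  exact ⟨mK_rightIntegral_left hR hlam hcyc φ, mK_rightIntegral_right hR hlam hcyc φ⟩

end
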